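/- Let S = x₁,…,x_s with s > 0 be in 𝔖, and set M(S) = F_{x₁}⁻F_{x₂}⁻⋯F_{x_{s−1}}⁻(L_{x_s}), where L_{x_s} is the simple projective k(Γ,σ_{x_{s−1}}⋯σ_{x₁}Λ)-module associated to the vertex x_s. If the word w(S) ∈ W is reduced, then M(S) is an indecomposable preprojective k(Γ,Λ)-module. -/

import Mathlib

namespace KP

/-! ## Quivers on a fixed vertex set `Fin n`.

An orientation is encoded by `Λ : Fin n → Fin n → ℕ`, where `Λ a b` is the number of
arrows from `a` to `b`.  The underlying graph is recorded by `edges Λ a b = Λ a b + Λ b a`. -/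

/-- The orientation `σ_x Λ` obtained by reversing every arrow incident with `x`. -/
def flipO {n : ℕ} (x : Fin n) (Λ : Fin n → Fin n → ℕ) : Fin n → Fin n → ℕ :=
  fun a b => if a = x ∨ b = x then Λ b a else Λ a b

/-- Number of edges of the underlying graph joining `a` and `b`. -/
def edges {n : ℕ} (Λ : Fin n → Fin n → ℕ) (a b : Fin n) : ℕ := Λ a b + Λ b a

/-- `x` is a sink: no arrow starts at `x`. -/
def IsSink {n : ℕ} (Λ : Fin n → Fin n → ℕ) (x : Fin n) : Prop := ∀ y, Λ x y = 0

/-- `S` is a `(+)`-admissible sequence of vertices on `(Γ, Λ)`. -/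
def Admissible {n : ℕ} (Λ : Fin n → Fin n → ℕ) : List (Fin n) → Prop
  | [] => True
  | x :: xs => IsSink Λ x ∧ Admissible (flipO x Λ) xs

/-- The orientation `Λ^S`. -/
def orientAfter {n : ℕ} (Λ : Fin n → Fin n → ℕ) : List (Fin n) → (Fin n → Fin n → ℕ)
  | [] => Λ
  | x :: xs => orientAfter (flipO x Λ) xs

/-- Elementary move: interchange two consecutive vertices not joined by an edge. -/
inductive SwapRel {n : ℕ} (E : Fin n → Fin n → ℕ) : List (Fin n) → List (Fin n) → Prop
  | swap (l₁ l₂ : List (Fin n)) (a b : Fin n) (h : E a b = 0) :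
      SwapRel E (l₁ ++ a :: b :: l₂) (l₁ ++ b :: a :: l₂)

/-- The equivalence `∼` on sequences of vertices: reflexive–transitive closure of the
(symmetric) relation `SwapRel`. -/
def Sim {n : ℕ} (E : Fin n → Fin n → ℕ) : List (Fin n) → List (Fin n) → Prop :=
  Relation.ReflTransGen (SwapRel E)

/-- The preorder `S ⪯ T` : `T ∼ S ++ U` for some `(+)`-admissible sequence `U` on `(Γ, Λ^S)`. -/
def Preceq {n : ℕ} (Λ : Fin n → Fin n → ℕ) (S T : List (Fin n)) : Prop :=
  ∃ U, Admissible (orientAfter Λ S) U ∧ Sim (edges Λ) T (S ++ U)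

/-- Support of a sequence of vertices. -/
def suppOf {n : ℕ} (S : List (Fin n)) : Set (Fin n) := {v | v ∈ S}

/-- The partial order on vertices: `x ≤ y` iff there is a path from `x` to `y` in `(Γ, Λ)`. -/
def PathLE {n : ℕ} (Λ : Fin n → Fin n → ℕ) (x y : Fin n) : Prop :=
  Relation.ReflTransGen (fun a b => Λ a b ≠ 0) x y

/-- A filter (up-closed set) of the poset `(Γ₀, Λ)`. -/
def IsFilter {n : ℕ} (Λ : Fin n → Fin n → ℕ) (F : Set (Fin n)) : Prop :=
  ∀ x ∈ F, ∀ y, PathLE Λ x y → y ∈ F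

/-- The principal filter `⟨x⟩`. -/
def upSet {n : ℕ} (Λ : Fin n → Fin n → ℕ) (x : Fin n) : Set (Fin n) := {y | PathLE Λ x y}

/-- The hull `H_Λ(F)`: the smallest filter containing `F` and every vertex joined
by an edge to a vertex of `F`. -/
def hull {n : ℕ} (Λ : Fin n → Fin n → ℕ) (F : Set (Fin n)) : Set (Fin n) :=
  {y | ∃ x, (x ∈ F ∨ ∃ z ∈ F, edges Λ z x ≠ 0) ∧ PathLE Λ x y}

/-- `segs` is a canonical form of `S` (Proposition 2.1): `S ∼ S₁S₂⋯S_r`, each segment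
consists of distinct vertices, is nonempty, and `Supp S_i = Supp (S_i S_{i+1} ⋯ S_r)`. -/
def Segments {n : ℕ} (Λ : Fin n → Fin n → ℕ) (S : List (Fin n))
    (segs : List (List (Fin n))) : Prop :=
  Admissible Λ segs.flatten ∧ Sim (edges Λ) S segs.flatten ∧
  (∀ seg ∈ segs, seg ≠ [] ∧ seg.Nodup) ∧
  ∀ i, i < segs.length → suppOf (segs.getD i []) = suppOf ((segs.drop i).flatten)

/-- `J` is (a representative of) the join `S ∨ T` (Definition 2.4):  the canonical form of `J`
has `Supp R_i = Supp S_i ∪ Supp T_i` (out-of-range segments read as `∅`). -/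
def IsJoin {n : ℕ} (Λ : Fin n → Fin n → ℕ) (S T J : List (Fin n)) : Prop :=
  ∃ CS CT CJ, Segments Λ S CS ∧ Segments Λ T CT ∧ Segments Λ J CJ ∧
    ∀ i, suppOf (CJ.getD i []) = suppOf (CS.getD i []) ∪ suppOf (CT.getD i [])

/-- `M` is (a representative of) the meet `S ∧ T` (Definition 2.4). -/
def IsMeet {n : ℕ} (Λ : Fin n → Fin n → ℕ) (S T M : List (Fin n)) : Prop :=
  ∃ CS CT CM, Segments Λ S CS ∧ Segments Λ T CT ∧ Segments Λ M CM ∧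
    ∀ i, suppOf (CM.getD i []) = suppOf (CS.getD i []) ∩ suppOf (CT.getD i [])

/-- `S` is (equivalent to) the join `T₁ ∨ ⋯ ∨ T_l` of the list of sequences `Ts`. -/
def IsJoinList {n : ℕ} (Λ : Fin n → Fin n → ℕ) : List (List (Fin n)) → List (Fin n) → Prop
  | [], S => S = []
  | T :: Ts, S => ∃ J, IsJoinList Λ Ts J ∧ IsJoin Λ T J S

/-- The segments of a canonical form of a principal sequence `S_{r,x}` (Definition 3.1). -/
def PrincipalSegs {n : ℕ} (Λ : Fin n → Fin n → ℕ) (segs : List (List (Fin n)))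
    (r : ℕ) (x : Fin n) : Prop :=
  segs.length = r ∧ 0 < r ∧
  (∀ i, i + 1 < r → suppOf (segs.getD i []) = hull Λ (suppOf (segs.getD (i+1) []))) ∧
  suppOf (segs.getD (r-1) []) = upSet Λ x

/-- `S ∼ S_{r,x}`, the principal `(+)`-admissible sequence of size `r` with
`Supp S_r = ⟨x⟩`. -/
def IsPrincipalSeq {n : ℕ} (Λ : Fin n → Fin n → ℕ) (r : ℕ) (x : Fin n)
    (S : List (Fin n)) : Prop :=
  ∃ segs, Segments Λ S segs ∧ PrincipalSegs Λ segs r x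

/-- `S` is a principal `(+)`-admissible sequence. -/
def IsPrincipal {n : ℕ} (Λ : Fin n → Fin n → ℕ) (S : List (Fin n)) : Prop :=
  ∃ r x, IsPrincipalSeq Λ r x S


/-! ## Representations of `(Γ, Λ)` over a field `k`. -/

/-- A (finite-dimensional) representation of the quiver `(Γ, Λ)` over `k`:
the space at vertex `x` is `Fin (d x) → k`, and each arrow carries a linear map. -/
structure Rep (k : Type) [Field k] (n : ℕ) (Λ : Fin n → Fin n → ℕ) where
  d : Fin n → ℕ
  f : ∀ a b : Fin n, Fin (Λ a b) → ((Fin (d a) → k) →ₗ[k] (Fin (d b) → k))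

variable {k : Type} [Field k] {n : ℕ}

/-- A morphism of representations. -/
structure RepHom {Λ : Fin n → Fin n → ℕ} (M N : Rep k n Λ) where
  g : ∀ x, (Fin (M.d x) → k) →ₗ[k] (Fin (N.d x) → k)
  comm : ∀ a b i v, g b (M.f a b i v) = N.f a b i (g a v)

/-- Isomorphism of representations. -/
def RepIso {Λ : Fin n → Fin n → ℕ} (M N : Rep k n Λ) : Prop :=
  ∃ g : ∀ x, (Fin (M.d x) → k) ≃ₗ[k] (Fin (N.d x) → k),
    ∀ a b i v, g b (M.f a b i v) = N.f a b i (g a v)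

/-- The zero representation. -/
def IsZeroRep {Λ : Fin n → Fin n → ℕ} (M : Rep k n Λ) : Prop := ∀ x, M.d x = 0

/-- Cast between the standard spaces. -/
def castL (k : Type) [Field k] {m m' : ℕ} (h : m = m') : (Fin m → k) ≃ₗ[k] (Fin m' → k) :=
  LinearEquiv.funCongrLeft k k (finCongr h.symm)

/-- The splitting `(Fin (m + p) → k) ≃ₗ (Fin m → k) × (Fin p → k)`. -/
def splitL (k : Type) [Field k] (m p : ℕ) : (Fin (m + p) → k) ≃ₗ[k] (Fin m → k) × (Fin p → k) :=
  (LinearEquiv.funCongrLeft k k finSumFinEquiv).trans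
    (LinearEquiv.sumArrowLequivProdArrow _ _ k k)

/-- Direct sum of two representations. -/
def dSum {Λ : Fin n → Fin n → ℕ} (M N : Rep k n Λ) : Rep k n Λ where
  d x := M.d x + N.d x
  f a b i :=
    (splitL k (M.d b) (N.d b)).symm.toLinearMap ∘ₗ
      (LinearMap.prodMap (M.f a b i) (N.f a b i)) ∘ₗ (splitL k (M.d a) (N.d a)).toLinearMap

/-- The zero representation (as an object). -/
def zeroRep (k : Type) [Field k] (n : ℕ) (Λ : Fin n → Fin n → ℕ) : Rep k n Λ where
  d _ := 0
  f _ _ _ := 0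

/-- Direct sum of a list of representations. -/
def dSumList {Λ : Fin n → Fin n → ℕ} (L : List (Rep k n Λ)) : Rep k n Λ :=
  L.foldr dSum (zeroRep k n Λ)

/-- `M` is indecomposable. -/
def Indecomp {Λ : Fin n → Fin n → ℕ} (M : Rep k n Λ) : Prop :=
  ¬ IsZeroRep M ∧ ∀ A B : Rep k n Λ, RepIso M (dSum A B) → IsZeroRep A ∨ IsZeroRep B

/-- `X` is a direct summand of `M`. -/
def IsSummand {Λ : Fin n → Fin n → ℕ} (X M : Rep k n Λ) : Prop :=
  ∃ Y, RepIso M (dSum X Y)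

/-! ### Reflection functors (on objects) -/

/-- Index type of the arrows ending at `x`. -/
abbrev Arin {n : ℕ} (Λ : Fin n → Fin n → ℕ) (x : Fin n) := Σ y : Fin n, Fin (Λ y x)

/-- Index type of the arrows starting at `x`. -/
abbrev Aout {n : ℕ} (Λ : Fin n → Fin n → ℕ) (x : Fin n) := Σ y : Fin n, Fin (Λ x y)

/-- The map `h : ⊕_{a : y → x} V(y) → V(x)` induced by the maps along the arrows ending at `x`. -/
noncomputable def inMap (Λ : Fin n → Fin n → ℕ) (M : Rep k n Λ) (x : Fin n) :
    ((p : Arin Λ x) → (Fin (M.d p.1) → k)) →ₗ[k] (Fin (M.d x) → k) :=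
  ∑ p : Arin Λ x, (M.f p.1 x p.2) ∘ₗ LinearMap.proj p

/-- The map `h' : V(x) → ⊕_{a : x → y} V(y)` induced by the maps along arrows starting at `x`. -/
def outMap (Λ : Fin n → Fin n → ℕ) (M : Rep k n Λ) (x : Fin n) :
    (Fin (M.d x) → k) →ₗ[k] ((p : Aout Λ x) → (Fin (M.d p.1) → k)) :=
  LinearMap.pi fun p => M.f x p.1 p.2

noncomputable def kerEquiv (Λ : Fin n → Fin n → ℕ) (M : Rep k n Λ) (x : Fin n) :
    LinearMap.ker (inMap Λ M x) ≃ₗ[k]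
      (Fin (Module.finrank k (LinearMap.ker (inMap Λ M x))) → k) :=
  (Module.finBasis k _).equivFun

noncomputable def cokerEquiv (Λ : Fin n → Fin n → ℕ) (M : Rep k n Λ) (x : Fin n) :
    (((p : Aout Λ x) → (Fin (M.d p.1) → k)) ⧸ LinearMap.range (outMap Λ M x)) ≃ₗ[k]
      (Fin (Module.finrank k (((p : Aout Λ x) → (Fin (M.d p.1) → k)) ⧸
        LinearMap.range (outMap Λ M x))) → k) :=
  (Module.finBasis k _).equivFun

/-- The positive reflection functor `F_x⁺` (on objects): the space at `x` is replaced
by the kernel of `inMap`, with the maps along the reversed arrows induced by inclusion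
followed by the projections. -/
noncomputable def reflPlus (x : Fin n) (Λ : Fin n → Fin n → ℕ) (M : Rep k n Λ) :
    Rep k n (flipO x Λ) where
  d z := if z = x then Module.finrank k (LinearMap.ker (inMap Λ M x)) else M.d z
  f a b i :=
    if ha : a = x then
      if hb : b = x then 0
      else
        (castL k (if_neg hb).symm).toLinearMap ∘ₗ
          (LinearMap.proj (φ := fun p : Arin Λ x => Fin (M.d p.1) → k)
            (⟨b, Fin.cast (by subst ha; simp [flipO]) i⟩ : Arin Λ x)) ∘ₗ
          (LinearMap.ker (inMap Λ M x)).subtype ∘ₗ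
          (kerEquiv Λ M x).symm.toLinearMap ∘ₗ (castL k (if_pos ha)).toLinearMap
    else
      if hb : b = x then 0
      else
        (castL k (if_neg hb).symm).toLinearMap ∘ₗ
          M.f a b (Fin.cast (by simp [flipO, ha, hb]) i) ∘ₗ
          (castL k (if_neg ha)).toLinearMap

/-- The negative reflection functor `F_x⁻` (on objects), presented as a map from
representations of `(Γ, σ_x Λ)` to representations of `(Γ, Λ)`: the space at `x` is
replaced by the cokernel of `outMap`. -/
noncomputable def reflMinus (x : Fin n) (Λ : Fin n → Fin n → ℕ)
    (N : Rep k n (flipO x Λ)) : Rep k n Λ where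
  d z := if z = x then
      Module.finrank k (((p : Aout (flipO x Λ) x) → (Fin (N.d p.1) → k)) ⧸
        LinearMap.range (outMap (flipO x Λ) N x))
    else N.d z
  f a b i :=
    if hb : b = x then
      if ha : a = x then 0
      else
        (castL k (if_pos hb).symm).toLinearMap ∘ₗ
          (cokerEquiv (flipO x Λ) N x).toLinearMap ∘ₗ
          (LinearMap.range (outMap (flipO x Λ) N x)).mkQ ∘ₗ
          (LinearMap.single k (fun p : Aout (flipO x Λ) x => Fin (N.d p.1) → k)
            (⟨a, Fin.cast (by subst hb; simp [flipO]) i⟩ : Aout (flipO x Λ) x)) ∘ₗ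
          (castL k (if_neg ha)).toLinearMap
    else
      if ha : a = x then 0
      else
        (castL k (if_neg hb).symm).toLinearMap ∘ₗ
          N.f a b (Fin.cast (by simp [flipO, ha, hb]) i) ∘ₗ
          (castL k (if_neg ha)).toLinearMap

/-- `F(S) = F_{x_s}⁺ ⋯ F_{x_1}⁺` applied to a representation. -/
noncomputable def FList : (S : List (Fin n)) → (Λ : Fin n → Fin n → ℕ) → Rep k n Λ →
    Rep k n (orientAfter Λ S)
  | [], _, M => M
  | x :: xs, Λ, M => FList xs (flipO x Λ) (reflPlus x Λ M)

/-- `S` annihilates `M` : `F(S) M = 0`. -/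
def Annihilates (Λ : Fin n → Fin n → ℕ) (S : List (Fin n)) (M : Rep k n Λ) : Prop :=
  IsZeroRep (FList S Λ M)

/-- `M` is preprojective: some `(+)`-admissible sequence annihilates it. -/
def Preprojective (Λ : Fin n → Fin n → ℕ) (M : Rep k n Λ) : Prop :=
  ∃ S, Admissible Λ S ∧ Annihilates Λ S M

/-- `S` is a shortest `(+)`-admissible sequence annihilating `M` : it annihilates `M` and no
proper subsequence of `S` annihilates `M`.  (This predicate is invariant under `∼`, so it
expresses `S ∼ S_M`.) -/
def IsShortestAnn (Λ : Fin n → Fin n → ℕ) (M : Rep k n Λ) (S : List (Fin n)) : Prop :=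
  Admissible Λ S ∧ Annihilates Λ S M ∧
  ∀ S', Admissible Λ S' → Annihilates Λ S' M → Preceq Λ S' S → Sim (edges Λ) S' S

/-- The simple representation `L_x` concentrated at the vertex `x`. -/
def simpleRep (Λ : Fin n → Fin n → ℕ) (x : Fin n) : Rep k n Λ where
  d z := if z = x then 1 else 0
  f _ _ _ := 0

/-- `M(S) = F_{x₁}⁻ F_{x₂}⁻ ⋯ F_{x_{s-1}}⁻ (L_{x_s})`, where `L_{x_s}` is the simple
(projective) module over `k(Γ, σ_{x_{s-1}} ⋯ σ_{x_1} Λ)` at the vertex `x_s`. -/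
noncomputable def Mof : (Λ : Fin n → Fin n → ℕ) → (S : List (Fin n)) → Rep k n Λ
  | Λ, [] => zeroRep k n Λ
  | Λ, [x] => simpleRep Λ x
  | Λ, x :: y :: ys => reflMinus x Λ (Mof (flipO x Λ) (y :: ys))

variable {n : ℕ}

/-! ## The Weyl group -/

/-- The simple reflection `σ_i` attached to a generalized Cartan matrix `A`,
as a linear endomorphism of `ℤⁿ` : `σ_i(v) = v - (∑ l, a_{il} v_l) e_i`. -/
def sigmaL (A : Fin n → Fin n → ℤ) (i : Fin n) : (Fin n → ℤ) →ₗ[ℤ] (Fin n → ℤ) where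
  toFun v := v - (∑ l, A i l * v l) • Pi.single i 1
  map_add' v w := by
    simp only [Pi.add_apply, mul_add, Finset.sum_add_distrib, add_smul]
    abel
  map_smul' c v := by
    simp only [Pi.smul_apply, smul_eq_mul, RingHom.id_apply, smul_sub]
    congr 1
    rw [smul_smul, Finset.mul_sum]
    congr 1
    exact Finset.sum_congr rfl fun l _ => by ring

theorem sigma_invol (A : Fin n → Fin n → ℤ) (hA : ∀ i, A i i = 2) (i : Fin n) :
    (sigmaL A i).comp (sigmaL A i) = LinearMap.id := by
  apply LinearMap.ext
  intro v
  simp only [LinearMap.comp_apply, LinearMap.id_apply, sigmaL, LinearMap.coe_mk, AddHom.coe_mk]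
  set c := ∑ l, A i l * v l with hc
  set s : Fin n → ℤ := Pi.single i 1 with hs
  have h1 : ∑ l, A i l * (v - c • s) l = -c := by
    have h2 : ∀ l, A i l * (v - c • s) l = A i l * v l - c * (A i l * s l) := fun l => by
      simp only [Pi.sub_apply, Pi.smul_apply, smul_eq_mul]
      ring
    rw [Finset.sum_congr rfl fun l _ => h2 l, Finset.sum_sub_distrib, ← Finset.mul_sum]
    have h3 : ∑ l, A i l * s l = 2 := by
      rw [Finset.sum_eq_single i]
      · simp [hs, hA i]
      · intro b _ hb
        simp [hs, Pi.single_eq_of_ne hb]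
      · simp
    rw [h3, ← hc]
    ring
  rw [h1]
  ext j
  simp only [Pi.sub_apply, Pi.smul_apply, smul_eq_mul]
  ring

/-- The simple reflection `σ_i` as an automorphism of `ℤⁿ`. -/
def sigmaE (A : Fin n → Fin n → ℤ) (hA : ∀ i, A i i = 2) (i : Fin n) :
    (Fin n → ℤ) ≃ₗ[ℤ] (Fin n → ℤ) :=
  LinearEquiv.ofLinear (sigmaL A i) (sigmaL A i) (sigma_invol A hA i) (sigma_invol A hA i)

/-- The length `ℓ(w)`: the least `l ≥ 0` such that `w` is a product of `l` simple
reflections. -/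
noncomputable def wordLen (A : Fin n → Fin n → ℤ) (hA : ∀ i, A i i = 2)
    (w : (Fin n → ℤ) ≃ₗ[ℤ] (Fin n → ℤ)) : ℕ :=
  sInf {l | ∃ ys : List (Fin n), ys.length = l ∧ w = (ys.map (sigmaE A hA)).prod}

/-- The word `w(S) = σ_{x_s} ⋯ σ_{x_1}` associated to a sequence `S = x₁, …, x_s`. -/
def wordOf (A : Fin n → Fin n → ℤ) (hA : ∀ i, A i i = 2) (S : List (Fin n)) :
    (Fin n → ℤ) ≃ₗ[ℤ] (Fin n → ℤ) :=
  ((S.reverse).map (sigmaE A hA)).prod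

/-- The symmetric generalized Cartan matrix of the underlying graph of `(Γ, Λ)`. -/
def cartanOf (Λ : Fin n → Fin n → ℕ) : Fin n → Fin n → ℤ :=
  fun i j => if i = j then 2 else -(edges Λ i j : ℤ)

theorem cartan_diag (Λ : Fin n → Fin n → ℕ) : ∀ i, cartanOf Λ i i = 2 := by
  intro i; simp [cartanOf]

/-- The simple reflections of the Weyl group of the underlying graph of `(Γ, Λ)`. -/
def wSig (Λ : Fin n → Fin n → ℕ) : Fin n → ((Fin n → ℤ) ≃ₗ[ℤ] (Fin n → ℤ)) :=
  sigmaE (cartanOf Λ) (cartan_diag Λ)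

/-- `w(S)` for a sequence of vertices of `(Γ, Λ)`. -/
def wordOfSeq (Λ : Fin n → Fin n → ℕ) (S : List (Fin n)) :
    (Fin n → ℤ) ≃ₗ[ℤ] (Fin n → ℤ) :=
  ((S.reverse).map (wSig Λ)).prod

/-- The word `w(S)` is reduced: `ℓ(w(S))` equals the number of letters of `S`. -/
noncomputable def IsReducedSeq (Λ : Fin n → Fin n → ℕ) (S : List (Fin n)) : Prop :=
  wordLen (cartanOf Λ) (cartan_diag Λ) (wordOfSeq Λ S) = S.length

/-! ## Dynkin graphs of types A, D, E -/

def edgeA (n : ℕ) : Fin n → Fin n → ℕ := fun i j =>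
  if (i : ℕ) + 1 = (j : ℕ) ∨ (j : ℕ) + 1 = (i : ℕ) then 1 else 0

def edgeD (n : ℕ) : Fin n → Fin n → ℕ := fun i j =>
  if ((i : ℕ) = 0 ∧ (j : ℕ) = 2) ∨ ((j : ℕ) = 0 ∧ (i : ℕ) = 2) ∨
     ((i : ℕ) = 1 ∧ (j : ℕ) = 2) ∨ ((j : ℕ) = 1 ∧ (i : ℕ) = 2) ∨
     (2 ≤ (i : ℕ) ∧ (i : ℕ) + 1 = (j : ℕ)) ∨ (2 ≤ (j : ℕ) ∧ (j : ℕ) + 1 = (i : ℕ))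
  then 1 else 0

def edgeE (n : ℕ) : Fin n → Fin n → ℕ := fun i j =>
  if ((i : ℕ) + 1 = (j : ℕ) ∧ (j : ℕ) ≤ n - 2) ∨ ((j : ℕ) + 1 = (i : ℕ) ∧ (i : ℕ) ≤ n - 2) ∨
     ((i : ℕ) = 2 ∧ (j : ℕ) = n - 1) ∨ ((j : ℕ) = 2 ∧ (i : ℕ) = n - 1)
  then 1 else 0

/-- The underlying graph (given by its edge-count function `E`) is a Dynkin diagram of
type `A`, `D`, or `E`. -/
def IsDynkinADE (n : ℕ) (E : Fin n → Fin n → ℕ) : Prop :=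
  ∃ e : Fin n ≃ Fin n,
    (∀ i j, E i j = edgeA n (e i) (e j)) ∨
    (4 ≤ n ∧ ∀ i j, E i j = edgeD n (e i) (e j)) ∨
    ((n = 6 ∨ n = 7 ∨ n = 8) ∧ ∀ i j, E i j = edgeE n (e i) (e j))

/-! ## Coxeter-sortable elements -/

/-- Lexicographic comparison of index tuples. -/
def lexLE {s : ℕ} (ι ι' : Fin s → ℕ) : Prop :=
  ι = ι' ∨ ∃ j, (∀ j', j' < j → ι j' = ι' j') ∧ ι j < ι' j

/-- `w` is `c`-sortable for the Coxeter element determined by the half-infinite word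
`cseq` (with dividers every `blockLen` letters): the lexicographically first subsequence
of `cseq` that is a reduced word for `w` defines a sequence of subsets (between adjacent
dividers) that is decreasing under inclusion. -/
def CSortable (A : Fin n → Fin n → ℤ) (hA : ∀ i, A i i = 2) (cseq : ℕ → Fin n)
    (blockLen : ℕ) (w : (Fin n → ℤ) ≃ₗ[ℤ] (Fin n → ℤ)) : Prop :=
  ∃ (s : ℕ) (ι : Fin s → ℕ), StrictMono ι ∧
    w = ((List.ofFn fun j => cseq (ι j)).map (sigmaE A hA)).prod ∧
    wordLen A hA w = s ∧
    (∀ ι' : Fin s → ℕ, StrictMono ι' →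
      w = ((List.ofFn fun j => cseq (ι' j)).map (sigmaE A hA)).prod → lexLE ι ι') ∧
    ∀ m : ℕ, {a : Fin n | ∃ j, (ι j) / blockLen = m + 1 ∧ cseq (ι j) = a} ⊆
             {a : Fin n | ∃ j, (ι j) / blockLen = m ∧ cseq (ι j) = a}


/-- A nonzero non-isomorphism between representations. -/
def RepStep {k : Type} [Field k] {n : ℕ} {Λ : Fin n → Fin n → ℕ} (X Y : Rep k n Λ) : Prop :=
  ∃ f : RepHom X Y, (∃ x v, f.g x v ≠ 0) ∧ ¬ ∀ x, Function.Bijective (f.g x)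

/-- `v` is a minimal element of `D` in the poset `(Γ₀, Λ)`. -/
def MinimalIn {n : ℕ} (Λ : Fin n → Fin n → ℕ) (D : Set (Fin n)) (v : Fin n) : Prop :=
  v ∈ D ∧ ∀ u ∈ D, PathLE Λ u v → u = v

/-- The pairs `(h, v)` of Proposition 3.2(a): `0 < h ≤ r` and `v` a minimal element of
`Supp S_h \ H_Λ(Supp S_{h+1})` (with `Supp S_{r+1} = ∅`). -/
def JoinPair {n : ℕ} (Λ : Fin n → Fin n → ℕ) (segs : List (List (Fin n)))
    (p : ℕ × Fin n) : Prop :=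
  0 < p.1 ∧ p.1 ≤ segs.length ∧
  MinimalIn Λ (suppOf (segs.getD (p.1 - 1) []) \ hull Λ (suppOf (segs.getD p.1 []))) p.2

/-! ## Auxiliary material -/

section Aux

/-- Brick: nonzero with only scalar endomorphisms. -/
def Brick {k : Type} [Field k] {n : ℕ} {Λ : Fin n → Fin n → ℕ} (M : Rep k n Λ) : Prop :=
  ¬ IsZeroRep M ∧ ∀ g : RepHom M M, ∃ c : k, ∀ x v, g.g x v = c • v

/-- Dimension vector. -/
def dimv {k : Type} [Field k] {n : ℕ} {Λ : Fin n → Fin n → ℕ} (M : Rep k n Λ) : Fin n → ℤ :=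
  fun z => (M.d z : ℤ)

theorem castL_symm_apply {k : Type} [Field k] {m m' : ℕ} (h : m = m') (v : Fin m → k) :
    castL k h.symm (castL k h v) = v := by
  subst h; rfl

theorem exists_fam {k : Type} [Field k] {n : ℕ} (d d' : Fin n → ℕ) (x : Fin n)
    (A : (Fin (d x) → k) →ₗ[k] (Fin (d' x) → k))
    (B : ∀ z, z ≠ x → ((Fin (d z) → k) →ₗ[k] (Fin (d' z) → k))) :
    ∃ g : ∀ z, (Fin (d z) → k) →ₗ[k] (Fin (d' z) → k), g x = A ∧ ∀ z (h : z ≠ x), g z = B z h := by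
  refine ⟨fun z => if h : z = x then h ▸ A else B z h, by simp, ?_⟩
  intro z h
  simp [h]

theorem Brick.indecomp {k : Type} [Field k] {n : ℕ} {Λ : Fin n → Fin n → ℕ} {M : Rep k n Λ}
    (h : Brick M) : Indecomp M := by
  refine ⟨h.1, ?_⟩
  rintro A B ⟨g, hg⟩
  let sp : ∀ x, (Fin ((dSum A B).d x) → k) ≃ₗ[k] (Fin (A.d x) → k) × (Fin (B.d x) → k) :=
    fun x => splitL k (A.d x) (B.d x)
  have hsp : ∀ a b i v, (dSum A B).f a b i v =
      (sp b).symm (A.f a b i (sp a v).1, B.f a b i (sp a v).2) := fun _ _ _ _ => rfl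
  clear_value sp
  let P : ∀ x, (Fin (M.d x) → k) →ₗ[k] (Fin (M.d x) → k) := fun x =>
    (g x).symm.toLinearMap ∘ₗ (sp x).symm.toLinearMap ∘ₗ
      (LinearMap.prodMap LinearMap.id 0) ∘ₗ (sp x).toLinearMap ∘ₗ (g x).toLinearMap
  have hPv : ∀ x v, P x v = (g x).symm ((sp x).symm ((sp x (g x v)).1, 0)) := fun _ _ => rfl
  have hP : ∀ a b i v, P b (M.f a b i v) = M.f a b i (P a v) := by
    intro a b i v
    apply (g b).injective
    rw [hg, hPv, hPv, LinearEquiv.apply_symm_apply, LinearEquiv.apply_symm_apply, hg, hsp, hsp]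
    simp
  obtain ⟨c, hc⟩ := h.2 ⟨P, hP⟩
  have key : ∀ x (u : (Fin (A.d x) → k)) (w : Fin (B.d x) → k), u = c • u ∧ 0 = c • w := by
    intro x u w
    have h1 := hc x ((g x).symm ((sp x).symm (u, w)))
    simp only [hPv, LinearEquiv.apply_symm_apply] at h1
    rw [← map_smul, ← map_smul] at h1
    have h2 := (sp x).symm.injective ((g x).symm.injective h1)
    exact ⟨congrArg Prod.fst h2, congrArg Prod.snd h2⟩
  by_cases hA : IsZeroRep A
  · exact Or.inl hA
  · right
    unfold IsZeroRep at hA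
    push Not at hA
    obtain ⟨x, hx⟩ := hA
    have hc1 : c = 1 := by
      have := (key x (fun _ => 1) 0).1
      have := congrFun this ⟨0, Nat.pos_of_ne_zero hx⟩
      simpa using this.symm
    intro y
    by_contra hy
    have := (key y 0 (fun _ => 1)).2
    have := congrFun this ⟨0, Nat.pos_of_ne_zero hy⟩
    simp [hc1] at this

theorem Brick.dimv_eq {k : Type} [Field k] {n : ℕ} {Λ : Fin n → Fin n → ℕ} {M : Rep k n Λ}
    (h : Brick M) (x : Fin n) (φ : (Fin (M.d x) → k) →ₗ[k] k) (v : Fin (M.d x) → k)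
    (hφ : φ v = 1) (h1 : ∀ a i w, φ (M.f a x i w) = 0) (h2 : ∀ b i, M.f x b i v = 0) :
    dimv M = Pi.single x 1 := by
  obtain ⟨P, hPx, hPz⟩ := exists_fam (k := k) M.d M.d x (φ.smulRight v) (fun _ _ => 0)
  have hP : ∀ a b i v, P b (M.f a b i v) = M.f a b i (P a v) := by
    intro a b i w
    by_cases ha : a = x
    · subst ha
      rw [hPx]
      by_cases hb : b = a
      · subst hb
        rw [hPx]; simp [h1, h2]
      · rw [hPz b hb]; simp [h2]
    · rw [hPz a ha]
      by_cases hb : b = x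
      · subst hb
        rw [hPx]; simp [h1]
      · rw [hPz b hb]; simp
  obtain ⟨c, hc⟩ := h.2 ⟨P, hP⟩
  simp only at hc
  have hv : v ≠ 0 := by rintro rfl; simp at hφ
  have hc1 : c = 1 := by
    have := hc x v
    rw [hPx] at this
    simp only [LinearMap.smulRight_apply, hφ] at this
    have h3 : (1 - c) • v = 0 := by rw [sub_smul, ← this, one_smul, sub_self]
    rcases smul_eq_zero.1 h3 with h4 | h4
    · exact (sub_eq_zero.1 h4).symm
    · exact absurd h4 hv
  subst hc1
  funext z
  by_cases hz : z = x
  · subst hz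
    have : Module.finrank k (Fin (M.d z) → k) = 1 := by
      apply finrank_eq_one v hv
      intro w
      refine ⟨φ w, ?_⟩
      have := hc z w
      rw [hPx] at this
      simpa using this
    simp at this
    simp [dimv, this]
  · rw [Pi.single_eq_of_ne hz]
    by_contra hd
    have hd' : M.d z ≠ 0 := by simpa [dimv] using hd
    have := hc z (fun _ => 1)
    rw [hPz z hz] at this
    have := congrFun this ⟨0, Nat.pos_of_ne_zero hd'⟩
    simp at this

theorem reflMinus_d_ne {k : Type} [Field k] {n : ℕ} (x : Fin n) (Λ : Fin n → Fin n → ℕ)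
    (X : Rep k n (flipO x Λ)) {z : Fin n} (hz : z ≠ x) : X.d z = (reflMinus x Λ X).d z :=
  (if_neg hz).symm

theorem reflMinus_d_self {k : Type} [Field k] {n : ℕ} (x : Fin n) (Λ : Fin n → Fin n → ℕ)
    (X : Rep k n (flipO x Λ)) :
    Module.finrank k (((p : Aout (flipO x Λ) x) → (Fin (X.d p.1) → k)) ⧸
      LinearMap.range (outMap (flipO x Λ) X x)) = (reflMinus x Λ X).d x :=
  (if_pos rfl).symm

theorem reflPlus_d_ne {k : Type} [Field k] {n : ℕ} (x : Fin n) (Λ : Fin n → Fin n → ℕ)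
    (X : Rep k n Λ) {z : Fin n} (hz : z ≠ x) : X.d z = (reflPlus x Λ X).d z :=
  (if_neg hz).symm

theorem reflPlus_d_self {k : Type} [Field k] {n : ℕ} (x : Fin n) (Λ : Fin n → Fin n → ℕ)
    (X : Rep k n Λ) :
    Module.finrank k (LinearMap.ker (inMap Λ X x)) = (reflPlus x Λ X).d x :=
  (if_pos rfl).symm

theorem reflMinus_f_ne {k : Type} [Field k] {n : ℕ} (x : Fin n) (Λ : Fin n → Fin n → ℕ)
    (X : Rep k n (flipO x Λ)) (a b : Fin n) (ha : a ≠ x) (hb : b ≠ x) (i : Fin (Λ a b)) :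
    (reflMinus x Λ X).f a b i = (castL k (reflMinus_d_ne x Λ X hb)).toLinearMap ∘ₗ
          X.f a b (Fin.cast (by simp [flipO, ha, hb]) i) ∘ₗ
          (castL k (reflMinus_d_ne x Λ X ha).symm).toLinearMap :=
  (dif_neg hb).trans (dif_neg ha)

theorem reflMinus_f_in {k : Type} [Field k] {n : ℕ} (x : Fin n) (Λ : Fin n → Fin n → ℕ)
    (X : Rep k n (flipO x Λ)) (a : Fin n) (ha : a ≠ x) (i : Fin (Λ a x)) :
    (reflMinus x Λ X).f a x i = (castL k (reflMinus_d_self x Λ X)).toLinearMap ∘ₗ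
          (cokerEquiv (flipO x Λ) X x).toLinearMap ∘ₗ
          (LinearMap.range (outMap (flipO x Λ) X x)).mkQ ∘ₗ
          (LinearMap.single k (fun p : Aout (flipO x Λ) x => Fin (X.d p.1) → k)
            (⟨a, Fin.cast (by simp [flipO]) i⟩ : Aout (flipO x Λ) x)) ∘ₗ
          (castL k (reflMinus_d_ne x Λ X ha).symm).toLinearMap :=
  (dif_pos rfl).trans (dif_neg ha)

theorem reflPlus_f_ne {k : Type} [Field k] {n : ℕ} (x : Fin n) (Λ : Fin n → Fin n → ℕ)
    (X : Rep k n Λ) (a b : Fin n) (ha : a ≠ x) (hb : b ≠ x) (i : Fin (flipO x Λ a b)) :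
    (reflPlus x Λ X).f a b i = (castL k (reflPlus_d_ne x Λ X hb)).toLinearMap ∘ₗ
          X.f a b (Fin.cast (by simp [flipO, ha, hb]) i) ∘ₗ
          (castL k (reflPlus_d_ne x Λ X ha).symm).toLinearMap :=
  (dif_neg ha).trans (dif_neg hb)

theorem reflPlus_f_out {k : Type} [Field k] {n : ℕ} (x : Fin n) (Λ : Fin n → Fin n → ℕ)
    (X : Rep k n Λ) (b : Fin n) (hb : b ≠ x) (i : Fin (flipO x Λ x b)) :
    (reflPlus x Λ X).f x b i = (castL k (reflPlus_d_ne x Λ X hb)).toLinearMap ∘ₗ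
          (LinearMap.proj (φ := fun p : Arin Λ x => Fin (X.d p.1) → k)
            (⟨b, Fin.cast (by simp [flipO]) i⟩ : Arin Λ x)) ∘ₗ
          (LinearMap.ker (inMap Λ X x)).subtype ∘ₗ
          (kerEquiv Λ X x).symm.toLinearMap ∘ₗ
          (castL k (reflPlus_d_self x Λ X).symm).toLinearMap :=
  (dif_pos rfl).trans (dif_neg hb)

theorem reflMinus_spec {k : Type} [Field k] {n : ℕ} (x : Fin n) (Λ : Fin n → Fin n → ℕ)
    (X : Rep k n (flipO x Λ)) :
    ∃ (e : ∀ z, z ≠ x → ((Fin (X.d z) → k) ≃ₗ[k] (Fin ((reflMinus x Λ X).d z) → k)))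
      (π : ((p : Aout (flipO x Λ) x) → (Fin (X.d p.1) → k)) →ₗ[k]
        (Fin ((reflMinus x Λ X).d x) → k)),
      Function.Surjective π ∧ LinearMap.ker π = LinearMap.range (outMap (flipO x Λ) X x) ∧
      (∀ a b (ha : a ≠ x) (hb : b ≠ x) (i : Fin (Λ a b)) (j : Fin (flipO x Λ a b)),
        i.val = j.val → ∀ v, (reflMinus x Λ X).f a b i (e a ha v) = e b hb (X.f a b j v)) ∧
      (∀ a (ha : a ≠ x) (i : Fin (Λ a x)) (j : Fin (flipO x Λ x a)), i.val = j.val → ∀ v,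
        (reflMinus x Λ X).f a x i (e a ha v) = π (Pi.single (⟨a, j⟩ : Aout (flipO x Λ) x) v)) := by
  refine ⟨fun z hz => castL k (reflMinus_d_ne x Λ X hz),
    (castL k (reflMinus_d_self x Λ X)).toLinearMap ∘ₗ
      (cokerEquiv (flipO x Λ) X x).toLinearMap ∘ₗ
          (LinearMap.range (outMap (flipO x Λ) X x)).mkQ, ?_, ?_, ?_, ?_⟩
  · intro y
    obtain ⟨y, rfl⟩ := (castL k (reflMinus_d_self x Λ X)).surjective y
    obtain ⟨y, rfl⟩ := (cokerEquiv (flipO x Λ) X x).surjective y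
    obtain ⟨y, rfl⟩ := Submodule.mkQ_surjective _ y
    exact ⟨y, rfl⟩
  · ext y
    simp
  · intro a b ha hb i j hij v
    have : Fin.cast (by simp [flipO, ha, hb]) i = j := Fin.ext hij
    subst this
    rw [reflMinus_f_ne x Λ X a b ha hb]
    simp only [LinearMap.comp_apply, LinearEquiv.coe_coe]
    rw [castL_symm_apply]
  · intro a ha i j hij v
    have : Fin.cast (by simp [flipO]) i = j := Fin.ext hij
    subst this
    rw [reflMinus_f_in x Λ X a ha]
    simp only [LinearMap.comp_apply, LinearEquiv.coe_coe]
    rw [castL_symm_apply]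
    rfl

theorem reflPlus_spec {k : Type} [Field k] {n : ℕ} (x : Fin n) (Λ : Fin n → Fin n → ℕ)
    (X : Rep k n Λ) :
    ∃ (e : ∀ z, z ≠ x → ((Fin (X.d z) → k) ≃ₗ[k] (Fin ((reflPlus x Λ X).d z) → k)))
      (ι : (Fin ((reflPlus x Λ X).d x) → k) →ₗ[k] ((p : Arin Λ x) → (Fin (X.d p.1) → k))),
      Function.Injective ι ∧ LinearMap.range ι = LinearMap.ker (inMap Λ X x) ∧
      (∀ a b (ha : a ≠ x) (hb : b ≠ x) (i : Fin (flipO x Λ a b)) (j : Fin (Λ a b)),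
        i.val = j.val → ∀ v, (reflPlus x Λ X).f a b i (e a ha v) = e b hb (X.f a b j v)) ∧
      (∀ b (hb : b ≠ x) (i : Fin (flipO x Λ x b)) (j : Fin (Λ b x)), i.val = j.val → ∀ v,
        (reflPlus x Λ X).f x b i v = e b hb (ι v (⟨b, j⟩ : Arin Λ x))) := by
  refine ⟨fun z hz => castL k (reflPlus_d_ne x Λ X hz),
    (LinearMap.ker (inMap Λ X x)).subtype ∘ₗ
          (kerEquiv Λ X x).symm.toLinearMap ∘ₗ
          (castL k (reflPlus_d_self x Λ X).symm).toLinearMap, ?_, ?_, ?_, ?_⟩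
  · intro y z h
    simpa using h
  · ext y
    constructor
    · rintro ⟨u, rfl⟩
      exact ((kerEquiv Λ X x).symm _).2
    · intro hy
      refine ⟨castL k (reflPlus_d_self x Λ X) (kerEquiv Λ X x ⟨y, hy⟩), ?_⟩
      simp only [LinearMap.comp_apply, LinearEquiv.coe_coe]
      rw [castL_symm_apply]
      simp
  · intro a b ha hb i j hij v
    have : Fin.cast (by simp [flipO, ha, hb]) i = j := Fin.ext hij
    subst this
    rw [reflPlus_f_ne x Λ X a b ha hb]
    simp only [LinearMap.comp_apply, LinearEquiv.coe_coe]
    rw [castL_symm_apply]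
  · intro b hb i j hij v
    have : Fin.cast (by simp [flipO]) i = j := Fin.ext hij
    subst this
    rw [reflPlus_f_out x Λ X b hb]
    rfl

theorem brick_minus {k : Type} [Field k] {n : ℕ} (x : Fin n) (Λ : Fin n → Fin n → ℕ)
    (hx : IsSink Λ x) (X : Rep k n (flipO x Λ)) (hX : Brick X)
    (hinj : Function.Injective (outMap (flipO x Λ) X x)) (g : RepHom (reflMinus x Λ X) (reflMinus x Λ X)) :
    ∃ c : k, ∀ z v, g.g z v = c • v := by
  obtain ⟨e, π, hπ, hker, he, heπ⟩ := reflMinus_spec x Λ X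
  have hne : ∀ p : Aout (flipO x Λ) x, p.1 ≠ x := by
    rintro ⟨y, j⟩ h
    change y = x at h
    subst h
    have : flipO y Λ y y = 0 := by simp [flipO, hx y]
    exact (Fin.cast this j).elim0
  let B : ∀ z, z ≠ x → ((Fin (X.d z) → k) →ₗ[k] (Fin (X.d z) → k)) := fun z hz =>
    (e z hz).symm.toLinearMap ∘ₗ g.g z ∘ₗ (e z hz).toLinearMap
  have hB : ∀ z hz v, e z hz (B z hz v) = g.g z (e z hz v) := by intro z hz v; simp [B]
  let G : ((p : Aout (flipO x Λ) x) → (Fin (X.d p.1) → k)) →ₗ[k]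
      ((p : Aout (flipO x Λ) x) → (Fin (X.d p.1) → k)) :=
    LinearMap.pi fun p => B p.1 (hne p) ∘ₗ LinearMap.proj p
  have hG : ∀ w p, G w p = B p.1 (hne p) (w p) := fun w p => rfl
  have hGs : ∀ p v, G (Pi.single p v) = Pi.single p (B p.1 (hne p) v) := by
    intro p v
    funext q
    rw [hG]
    by_cases hq : q = p
    · subst hq; simp
    · rw [Pi.single_eq_of_ne hq, Pi.single_eq_of_ne hq, map_zero]
  have hπG : ∀ w, π (G w) = g.g x (π w) := by
    have : π ∘ₗ G = g.g x ∘ₗ π := by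
      apply LinearMap.pi_ext
      rintro ⟨a, j⟩ v
      simp only [LinearMap.comp_apply]
      rw [hGs]
      have hc : flipO x Λ x a = Λ a x := by simp [flipO]
      have ha := hne ⟨a, j⟩
      rw [← heπ a ha (Fin.cast hc j) j rfl, ← heπ a ha (Fin.cast hc j) j rfl, g.comm, hB]
    intro w
    exact LinearMap.congr_fun this w
  obtain ⟨r, hr⟩ := LinearMap.exists_leftInverse_of_injective _ (LinearMap.ker_eq_bot.2 hinj)
  have hr' : ∀ v, outMap (flipO x Λ) X x (r (G (outMap (flipO x Λ) X x v))) =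
      G (outMap (flipO x Λ) X x v) := by
    intro v
    have : G (outMap (flipO x Λ) X x v) ∈ LinearMap.range (outMap (flipO x Λ) X x) := by
      rw [← hker, LinearMap.mem_ker, hπG]
      have : outMap (flipO x Λ) X x v ∈ LinearMap.ker π := by rw [hker]; exact ⟨v, rfl⟩
      rw [LinearMap.mem_ker.1 this, map_zero]
    obtain ⟨u, hu⟩ := this
    rw [← hu]
    congr 1
    exact LinearMap.congr_fun hr u
  obtain ⟨P, hPx, hPz⟩ := exists_fam (k := k) X.d X.d x (r ∘ₗ G ∘ₗ outMap (flipO x Λ) X x) B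
  have hP : ∀ a b i v, P b (X.f a b i v) = X.f a b i (P a v) := by
    intro a b i v
    by_cases hb : b = x
    · subst hb
      have : flipO b Λ a b = 0 := by simp [flipO, hx a]
      exact (Fin.cast this i).elim0
    · rw [hPz b hb]
      by_cases ha : a = x
      · subst ha
        rw [hPx]
        exact (congrFun (hr' v) ⟨b, i⟩).symm
      · rw [hPz a ha]
        apply (e b hb).injective
        have hc : flipO x Λ a b = Λ a b := by simp [flipO, ha, hb]
        rw [hB, ← he a b ha hb (Fin.cast hc i) i rfl, ← he a b ha hb (Fin.cast hc i) i rfl, hB,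
          g.comm]
  obtain ⟨c, hc⟩ := hX.2 ⟨P, hP⟩
  simp only at hc
  have hBc : ∀ z hz v, B z hz v = c • v := by
    intro z hz v; rw [← hPz z hz]; exact hc z v
  refine ⟨c, ?_⟩
  intro z v
  by_cases hz : z = x
  · subst hz
    obtain ⟨w, rfl⟩ := hπ v
    rw [← hπG, ← map_smul]
    congr 1
    funext p
    rw [hG, hBc]; rfl
  · obtain ⟨w, rfl⟩ := (e z hz).surjective v
    rw [← hB, hBc, map_smul]

theorem inMap_single {k : Type} [Field k] {n : ℕ} (Λ : Fin n → Fin n → ℕ) (X : Rep k n Λ)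
    (x : Fin n) (p : Arin Λ x) (v : Fin (X.d p.1) → k) :
    inMap Λ X x (Pi.single p v) = X.f p.1 x p.2 v := by
  simp only [inMap, LinearMap.sum_apply, LinearMap.comp_apply, LinearMap.proj_apply]
  rw [Finset.sum_eq_single p]
  · simp
  · intro q _ hq
    rw [Pi.single_eq_of_ne hq, map_zero]
  · simp

theorem brick_plus {k : Type} [Field k] {n : ℕ} (x : Fin n) (Λ : Fin n → Fin n → ℕ)
    (hx : IsSink Λ x) (X : Rep k n Λ) (hX : Brick X)
    (hsurj : Function.Surjective (inMap Λ X x)) (g : RepHom (reflPlus x Λ X) (reflPlus x Λ X)) :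
    ∃ c : k, ∀ z v, g.g z v = c • v := by
  obtain ⟨e, ι, hι, hran, he, heι⟩ := reflPlus_spec x Λ X
  have hne : ∀ p : Arin Λ x, p.1 ≠ x := by
    rintro ⟨y, j⟩ h
    change y = x at h
    subst h
    exact (Fin.cast (hx y) j).elim0
  let B : ∀ z, z ≠ x → ((Fin (X.d z) → k) →ₗ[k] (Fin (X.d z) → k)) := fun z hz =>
    (e z hz).symm.toLinearMap ∘ₗ g.g z ∘ₗ (e z hz).toLinearMap
  have hB : ∀ z hz v, e z hz (B z hz v) = g.g z (e z hz v) := by intro z hz v; simp [B]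
  let G : ((p : Arin Λ x) → (Fin (X.d p.1) → k)) →ₗ[k]
      ((p : Arin Λ x) → (Fin (X.d p.1) → k)) :=
    LinearMap.pi fun p => B p.1 (hne p) ∘ₗ LinearMap.proj p
  have hG : ∀ w p, G w p = B p.1 (hne p) (w p) := fun w p => rfl
  have hGs : ∀ p v, G (Pi.single p v) = Pi.single p (B p.1 (hne p) v) := by
    intro p v
    funext q
    rw [hG]
    by_cases hq : q = p
    · subst hq; simp
    · rw [Pi.single_eq_of_ne hq, Pi.single_eq_of_ne hq, map_zero]
  have hιG : ∀ u, G (ι u) = ι (g.g x u) := by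
    intro u
    funext ⟨b, j⟩
    have hb := hne ⟨b, j⟩
    have hc : Λ b x = flipO x Λ x b := by simp [flipO]
    apply (e b hb).injective
    rw [hG, hB, ← heι b hb (Fin.cast hc j) j rfl, ← heι b hb (Fin.cast hc j) j rfl, g.comm]
  obtain ⟨s, hs⟩ := LinearMap.exists_rightInverse_of_surjective _ (LinearMap.range_eq_top.2 hsurj)
  have hs' : ∀ w, inMap Λ X x (G (s (inMap Λ X x w))) = inMap Λ X x (G w) := by
    intro w
    have : s (inMap Λ X x w) - w ∈ LinearMap.range ι := by
      rw [hran, LinearMap.mem_ker, map_sub, sub_eq_zero]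
      exact LinearMap.congr_fun hs _
    obtain ⟨u, hu⟩ := this
    rw [← sub_eq_zero, ← map_sub, ← map_sub, ← hu, hιG, ← LinearMap.mem_ker, ← hran]
    exact ⟨_, rfl⟩
  obtain ⟨P, hPx, hPz⟩ := exists_fam (k := k) X.d X.d x (inMap Λ X x ∘ₗ G ∘ₗ s) B
  have hP : ∀ a b i v, P b (X.f a b i v) = X.f a b i (P a v) := by
    intro a b i v
    by_cases ha : a = x
    · subst ha
      exact (Fin.cast (hx b) i).elim0
    · rw [hPz a ha]
      by_cases hb : b = x
      · subst hb
        rw [hPx]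
        have h1 := inMap_single Λ X b ⟨a, i⟩ v
        have h2 := inMap_single Λ X b ⟨a, i⟩ (B a ha v)
        simp only at h1 h2
        rw [← h1, ← h2]
        simp only [LinearMap.comp_apply]
        rw [hs', hGs]
      · rw [hPz b hb]
        apply (e b hb).injective
        have hc : Λ a b = flipO x Λ a b := by simp [flipO, ha, hb]
        rw [hB, ← he a b ha hb (Fin.cast hc i) i rfl, ← he a b ha hb (Fin.cast hc i) i rfl, hB,
          g.comm]
  obtain ⟨c, hc⟩ := hX.2 ⟨P, hP⟩
  simp only at hc
  have hBc : ∀ z hz v, B z hz v = c • v := by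
    intro z hz v; rw [← hPz z hz]; exact hc z v
  refine ⟨c, ?_⟩
  intro z v
  by_cases hz : z = x
  · subst hz
    apply hι
    rw [← hιG, map_smul]
    funext p
    rw [hG, hBc]; rfl
  · obtain ⟨w, rfl⟩ := (e z hz).surjective v
    rw [← hB, hBc, map_smul]

/-! ### Non-injective / non-surjective cases -/

theorem brick_out {k : Type} [Field k] {n : ℕ} (x : Fin n) (Λ : Fin n → Fin n → ℕ)
    (hx : IsSink Λ x) (X : Rep k n (flipO x Λ)) (hX : Brick X)
    (hinj : ¬ Function.Injective (outMap (flipO x Λ) X x)) : dimv X = Pi.single x 1 := by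
  rw [← LinearMap.ker_eq_bot, Submodule.eq_bot_iff] at hinj
  push Not at hinj
  obtain ⟨v, hv, hv0⟩ := hinj
  obtain ⟨φ, hφ⟩ : ∃ φ : (Fin (X.d x) → k) →ₗ[k] k, φ v = 1 := by
    obtain ⟨i, hi⟩ := Function.ne_iff.1 hv0
    exact ⟨(v i)⁻¹ • LinearMap.proj i, by simpa using inv_mul_cancel₀ hi⟩
  refine hX.dimv_eq x φ v hφ ?_ ?_
  · intro a i
    have : flipO x Λ a x = 0 := by simp [flipO, hx a]
    exact (Fin.cast this i).elim0
  · intro b i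
    exact congrFun (LinearMap.mem_ker.1 hv) ⟨b, i⟩

theorem brick_in {k : Type} [Field k] {n : ℕ} (x : Fin n) (Λ : Fin n → Fin n → ℕ)
    (hx : IsSink Λ x) (X : Rep k n Λ) (hX : Brick X)
    (hsurj : ¬ Function.Surjective (inMap Λ X x)) : dimv X = Pi.single x 1 := by
  rw [← LinearMap.range_eq_top] at hsurj
  obtain ⟨φ, hφ0, hφ⟩ := Submodule.exists_le_ker_of_lt_top _ (lt_top_iff_ne_top.2 hsurj)
  obtain ⟨v, hv⟩ : ∃ v, φ v ≠ 0 := by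
    by_contra h
    push Not at h
    exact hφ0 (LinearMap.ext h)
  refine hX.dimv_eq x φ ((φ v)⁻¹ • v) (by simp [hv]) ?_ ?_
  · intro a i w
    exact hφ ⟨_, inMap_single Λ X x ⟨a, i⟩ w⟩
  · intro b i
    exact (Fin.cast (hx b) i).elim0

/-! ### Dimension vectors -/

theorem sigma_apply_ne {n : ℕ} (A : Fin n → Fin n → ℤ) (x z : Fin n) (v : Fin n → ℤ) (h : z ≠ x) :
    sigmaL A x v z = v z := by
  simp [sigmaL, Pi.single_eq_of_ne h]

theorem sigma_apply_self {n : ℕ} (Λ : Fin n → Fin n → ℕ) (x : Fin n) (v : Fin n → ℤ)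
    (hx : IsSink Λ x) : sigmaL (cartanOf Λ) x v x = (∑ y, (Λ y x : ℤ) * v y) - v x := by
  have h : ∀ l, cartanOf Λ x l * v l = (if l = x then 2 * v x else 0) - (Λ l x : ℤ) * v l := by
    intro l
    by_cases hl : l = x
    · subst hl; simp [cartanOf, hx l]
    · simp [cartanOf, edges, hx l, hl, Ne.symm hl]
  simp only [sigmaL, LinearMap.coe_mk, AddHom.coe_mk, Pi.sub_apply, Pi.smul_apply,
    Pi.single_eq_same, smul_eq_mul, h, Finset.sum_sub_distrib]
  simp
  ring

theorem finrank_sigma {k : Type} [Field k] {n : ℕ} (m d : Fin n → ℕ) :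
    Module.finrank k ((p : Σ y : Fin n, Fin (m y)) → (Fin (d p.1) → k)) = ∑ y, m y * d y := by
  rw [Module.finrank_pi_fintype]
  simp only [Module.finrank_fin_fun]
  rw [Fintype.sum_sigma]
  simp

theorem dimv_minus {k : Type} [Field k] {n : ℕ} (x : Fin n) (Λ : Fin n → Fin n → ℕ)
    (hx : IsSink Λ x) (X : Rep k n (flipO x Λ))
    (hinj : Function.Injective (outMap (flipO x Λ) X x)) :
    dimv (reflMinus x Λ X) = sigmaL (cartanOf Λ) x (dimv X) := by
  funext z
  by_cases hz : z = x
  · subst hz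
    rw [sigma_apply_self Λ z _ hx]
    have h1 := Submodule.finrank_quotient_add_finrank (LinearMap.range (outMap (flipO z Λ) X z))
    rw [LinearMap.finrank_range_of_inj hinj, finrank_sigma, Module.finrank_fin_fun] at h1
    have h2 : ∀ y, flipO z Λ z y = Λ y z := by intro y; simp [flipO]
    simp only [h2] at h1
    have h3 : (reflMinus z Λ X).d z = Module.finrank k (((p : Aout (flipO z Λ) z) →
      (Fin (X.d p.1) → k)) ⧸ LinearMap.range (outMap (flipO z Λ) X z)) := by simp [reflMinus]
    simp only [dimv, h3]
    rw [eq_sub_iff_add_eq]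
    exact_mod_cast h1
  · rw [sigma_apply_ne _ _ _ _ hz]
    simp [dimv, reflMinus, hz]

theorem dimv_plus {k : Type} [Field k] {n : ℕ} (x : Fin n) (Λ : Fin n → Fin n → ℕ)
    (hx : IsSink Λ x) (X : Rep k n Λ) (hsurj : Function.Surjective (inMap Λ X x)) :
    dimv (reflPlus x Λ X) = sigmaL (cartanOf Λ) x (dimv X) := by
  funext z
  by_cases hz : z = x
  · subst hz
    rw [sigma_apply_self Λ z _ hx]
    have h1 := LinearMap.finrank_range_add_finrank_ker (inMap Λ X z)
    rw [LinearMap.range_eq_top.2 hsurj, finrank_top, finrank_sigma, Module.finrank_fin_fun] at h1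
    have h3 : (reflPlus z Λ X).d z = Module.finrank k (LinearMap.ker (inMap Λ X z)) := by
      simp [reflPlus]
    simp only [dimv, h3]
    rw [eq_sub_iff_add_eq, add_comm]
    exact_mod_cast h1
  · rw [sigma_apply_ne _ _ _ _ hz]
    simp [dimv, reflPlus, hz]

theorem isZero_iff {k : Type} [Field k] {n : ℕ} {Λ : Fin n → Fin n → ℕ} (M : Rep k n Λ) :
    IsZeroRep M ↔ dimv M = 0 := by
  simp [IsZeroRep, dimv, funext_iff]

theorem sigma_sigma {n : ℕ} (A : Fin n → Fin n → ℤ) (hA : ∀ i, A i i = 2) (i : Fin n)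
    (v : Fin n → ℤ) : sigmaL A i (sigmaL A i v) = v :=
  LinearMap.congr_fun (sigma_invol A hA i) v

theorem sigma_ne_zero {n : ℕ} (A : Fin n → Fin n → ℤ) (hA : ∀ i, A i i = 2) (i : Fin n)
    (v : Fin n → ℤ) (h : v ≠ 0) : sigmaL A i v ≠ 0 := by
  intro h0
  apply h
  rw [← sigma_sigma A hA i v, h0, map_zero]

theorem cartan_flip {n : ℕ} (x : Fin n) (Λ : Fin n → Fin n → ℕ) :
    cartanOf (flipO x Λ) = cartanOf Λ := by
  funext i j
  simp only [cartanOf, edges, flipO]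
  by_cases h : i = x ∨ j = x
  · rw [if_pos h, if_pos h.symm, add_comm]
  · have h' : ¬ (j = x ∨ i = x) := fun t => h t.symm
    simp only [if_neg h, if_neg h']

theorem Brick.minus {k : Type} [Field k] {n : ℕ} (x : Fin n) (Λ : Fin n → Fin n → ℕ)
    (hx : IsSink Λ x) (X : Rep k n (flipO x Λ)) (hX : Brick X)
    (hinj : Function.Injective (outMap (flipO x Λ) X x)) : Brick (reflMinus x Λ X) := by
  refine ⟨?_, brick_minus x Λ hx X hX hinj⟩
  rw [isZero_iff, dimv_minus x Λ hx X hinj]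
  exact sigma_ne_zero _ (cartan_diag Λ) _ _ (fun h => hX.1 ((isZero_iff X).2 h))

theorem Brick.plus {k : Type} [Field k] {n : ℕ} (x : Fin n) (Λ : Fin n → Fin n → ℕ)
    (hx : IsSink Λ x) (X : Rep k n Λ) (hX : Brick X)
    (hsurj : Function.Surjective (inMap Λ X x)) : Brick (reflPlus x Λ X) := by
  refine ⟨?_, brick_plus x Λ hx X hX hsurj⟩
  rw [isZero_iff, dimv_plus x Λ hx X hsurj]
  exact sigma_ne_zero _ (cartan_diag Λ) _ _ (fun h => hX.1 ((isZero_iff X).2 h))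

theorem plus_zero {k : Type} [Field k] {n : ℕ} (x : Fin n) (Λ : Fin n → Fin n → ℕ)
    (hx : IsSink Λ x) (X : Rep k n Λ) (h : ∀ z, z ≠ x → X.d z = 0) :
    IsZeroRep (reflPlus x Λ X) := by
  intro z
  by_cases hz : z = x
  · subst hz
    have h3 : (reflPlus z Λ X).d z = Module.finrank k (LinearMap.ker (inMap Λ X z)) := by
      simp [reflPlus]
    rw [h3, ← Nat.le_zero]
    refine (Submodule.finrank_le _).trans ?_
    rw [Module.finrank_pi_fintype]
    apply le_of_eq
    apply Finset.sum_eq_zero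
    rintro ⟨y, j⟩ _
    rw [Module.finrank_fin_fun]
    apply h
    intro hy
    change y = z at hy
    subst hy
    exact (Fin.cast (hx _) j).elim0
  · simp [reflPlus, hz, h z hz]

theorem FList_zero {k : Type} [Field k] {n : ℕ} (S : List (Fin n)) :
    ∀ (Λ : Fin n → Fin n → ℕ) (M : Rep k n Λ), Admissible Λ S → IsZeroRep M →
      IsZeroRep (FList S Λ M) := by
  induction S with
  | nil => intro Λ M _ h; exact h
  | cons x xs ih =>
    intro Λ M hS h
    exact ih _ _ hS.2 (plus_zero x Λ hS.1 M (fun z _ => h z))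

/-- The vector `σ_{x₁} ⋯ σ_{x_{s-1}} e_{x_s}`. -/
def rootOf {n : ℕ} (A : Fin n → Fin n → ℤ) : List (Fin n) → (Fin n → ℤ)
  | [] => 0
  | [x] => Pi.single x 1
  | x :: y :: ys => sigmaL A x (rootOf A (y :: ys))

theorem preproj_aux {k : Type} [Field k] {n : ℕ} (S : List (Fin n)) :
    ∀ (Λ : Fin n → Fin n → ℕ) (M : Rep k n Λ), Admissible Λ S → S ≠ [] → Brick M →
      dimv M = rootOf (cartanOf Λ) S → IsZeroRep (FList S Λ M) := by
  have aux : ∀ (Λ : Fin n → Fin n → ℕ) (M : Rep k n Λ) x, dimv M = Pi.single x 1 →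
      ∀ z, z ≠ x → M.d z = 0 := by
    intro Λ M x h z hz
    have := congrFun h z
    rw [Pi.single_eq_of_ne hz] at this
    simpa [dimv] using this
  induction S with
  | nil => intro _ _ _ h; exact absurd rfl h
  | cons x xs ih =>
    intro Λ M hS _ hM hd
    by_cases hs : Function.Surjective (inMap Λ M x)
    · cases xs with
      | nil => exact plus_zero x Λ hS.1 M (aux Λ M x hd)
      | cons y ys =>
        refine ih _ _ hS.2 (by simp) (hM.plus x Λ hS.1 M hs) ?_
        rw [dimv_plus x Λ hS.1 M hs, cartan_flip, hd]
        exact sigma_sigma _ (cartan_diag Λ) _ _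
    · exact FList_zero xs _ _ hS.2 (plus_zero x Λ hS.1 M (aux Λ M x (brick_in x Λ hS.1 M hM hs)))

/-! ### Weyl group -/

theorem sigma_form {n : ℕ} (A : Fin n → Fin n → ℤ) (i : Fin n) (v : Fin n → ℤ) :
    sigmaL A i v = v - (∑ l, A i l * v l) • Pi.single i 1 := rfl

/-- The bilinear form of `A`. -/
noncomputable def bil {n : ℕ} (A : Fin n → Fin n → ℤ) :
    (Fin n → ℤ) →ₗ[ℤ] (Fin n → ℤ) →ₗ[ℤ] ℤ := Matrix.toLinearMap₂' ℤ (Matrix.of A)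

theorem bil_single {n : ℕ} (A : Fin n → Fin n → ℤ) (i : Fin n) (v : Fin n → ℤ) :
    bil A (Pi.single i 1) v = ∑ l, A i l * v l := by
  simp only [bil, Matrix.toLinearMap₂'_apply', Matrix.mulVec, dotProduct, Matrix.of_apply]
  rw [Finset.sum_eq_single i]
  · simp
  · intro j _ hj; simp [Pi.single_eq_of_ne hj]
  · simp

theorem bil_symm {n : ℕ} (A : Fin n → Fin n → ℤ) (hs : ∀ i j, A i j = A j i) (u v : Fin n → ℤ) :
    bil A u v = bil A v u := by
  simp only [bil, Matrix.toLinearMap₂'_apply, Matrix.of_apply]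
  rw [Finset.sum_comm]
  refine Finset.sum_congr rfl fun i _ => Finset.sum_congr rfl fun j _ => ?_
  rw [hs i j]
  simp only [smul_eq_mul]
  ring

theorem sigma_bil {n : ℕ} (A : Fin n → Fin n → ℤ) (i : Fin n) (v : Fin n → ℤ) :
    sigmaL A i v = v - bil A (Pi.single i 1) v • Pi.single i 1 := by
  rw [bil_single, sigma_form]

theorem bil_inv {n : ℕ} (A : Fin n → Fin n → ℤ) (hA : ∀ i, A i i = 2)
    (hs : ∀ i j, A i j = A j i) (i : Fin n) (u v : Fin n → ℤ) :
    bil A (sigmaL A i u) (sigmaL A i v) = bil A u v := by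
  have h2 : bil A (Pi.single i 1) (Pi.single i 1) = 2 := by
    rw [bil_single, Finset.sum_eq_single i]
    · simp [hA]
    · intro j _ hj; simp [Pi.single_eq_of_ne hj]
    · simp
  rw [sigma_bil, sigma_bil]
  simp only [map_sub, map_smul, LinearMap.sub_apply, LinearMap.smul_apply, smul_eq_mul, h2]
  rw [bil_symm A hs u (Pi.single i 1)]
  ring

theorem bil_inv_prod {n : ℕ} (A : Fin n → Fin n → ℤ) (hA : ∀ i, A i i = 2)
    (hs : ∀ i j, A i j = A j i) (T : List (Fin n)) (u v : Fin n → ℤ) :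
    bil A ((T.map (sigmaE A hA)).prod u) ((T.map (sigmaE A hA)).prod v) = bil A u v := by
  induction T with
  | nil => simp
  | cons x xs ih =>
    rw [List.map_cons, List.prod_cons, LinearEquiv.mul_apply, LinearEquiv.mul_apply]
    exact (bil_inv A hA hs x _ _).trans ih

theorem conj_sigma {n : ℕ} (A : Fin n → Fin n → ℤ) (hA : ∀ i, A i i = 2)
    (hs : ∀ i j, A i j = A j i) (T : List (Fin n)) (a z : Fin n)
    (h : (T.map (sigmaE A hA)).prod (Pi.single z 1) = Pi.single a 1) :
    ((a :: (T ++ [z])).map (sigmaE A hA)).prod = (T.map (sigmaE A hA)).prod := by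
  have key : (T.map (sigmaE A hA)).prod * sigmaE A hA z =
      sigmaE A hA a * (T.map (sigmaE A hA)).prod := by
    apply LinearEquiv.ext
    intro v
    rw [LinearEquiv.mul_apply, LinearEquiv.mul_apply]
    change (T.map (sigmaE A hA)).prod (sigmaL A z v) = sigmaL A a _
    rw [sigma_bil, sigma_bil, map_sub, map_smul, h]
    congr 2
    rw [← h, bil_inv_prod A hA hs]
  rw [List.map_cons, List.prod_cons, List.map_append, List.prod_append]
  simp only [List.map_cons, List.map_nil, List.prod_singleton]
  rw [key, ← mul_assoc]
  have : sigmaE A hA a * sigmaE A hA a = 1 := by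
    apply LinearEquiv.ext
    intro v
    exact sigma_sigma A hA a v
  rw [this, one_mul]

/-- `S` is a reduced word. -/
def Red {n : ℕ} (A : Fin n → Fin n → ℤ) (hA : ∀ i, A i i = 2) (S : List (Fin n)) : Prop :=
  ∀ T : List (Fin n), (S.map (sigmaE A hA)).prod = (T.map (sigmaE A hA)).prod →
    S.length ≤ T.length

theorem Red.tail {n : ℕ} {A : Fin n → Fin n → ℤ} {hA : ∀ i, A i i = 2} {x : Fin n}
    {S : List (Fin n)} (h : Red A hA (x :: S)) : Red A hA S := by
  intro T hT
  have := h (x :: T) (by simp only [List.map_cons, List.prod_cons, hT])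
  simpa using this

theorem prod_reverse {n : ℕ} (A : Fin n → Fin n → ℤ) (hA : ∀ i, A i i = 2) (S : List (Fin n)) :
    (S.reverse.map (sigmaE A hA)).prod = ((S.map (sigmaE A hA)).prod)⁻¹ := by
  induction S with
  | nil => simp
  | cons x xs ih =>
    have : sigmaE A hA x * sigmaE A hA x = 1 := by
      apply LinearEquiv.ext
      intro v
      exact sigma_sigma A hA x v
    rw [List.reverse_cons, List.map_append, List.prod_append, ih]
    simp only [List.map_cons, List.map_nil, List.prod_cons, List.prod_nil, mul_one, mul_inv_rev]
    rw [← eq_inv_of_mul_eq_one_left this]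

theorem red_of_reduced {n : ℕ} (Λ : Fin n → Fin n → ℕ) (S : List (Fin n))
    (h : IsReducedSeq Λ S) : Red (cartanOf Λ) (cartan_diag Λ) S := by
  intro T hT
  unfold IsReducedSeq wordLen at h
  rw [← h]
  apply Nat.sInf_le
  refine ⟨T.reverse, by simp, ?_⟩
  rw [prod_reverse, ← hT, ← prod_reverse]
  rfl

theorem rootOf_append {n : ℕ} (A : Fin n → Fin n → ℤ) (hA : ∀ i, A i i = 2)
    (T : List (Fin n)) (z : Fin n) :
    rootOf A (T ++ [z]) = (T.map (sigmaE A hA)).prod (Pi.single z 1) := by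
  induction T with
  | nil => simp [rootOf]
  | cons x xs ih =>
    rw [List.map_cons, List.prod_cons, LinearEquiv.mul_apply, ← ih]
    cases xs with
    | nil => rfl
    | cons y ys => rfl

theorem red_root_ne {n : ℕ} (A : Fin n → Fin n → ℤ) (hA : ∀ i, A i i = 2)
    (hs : ∀ i j, A i j = A j i) (x : Fin n) (S : List (Fin n)) (hS : S ≠ [])
    (h : Red A hA (x :: S)) : rootOf A S ≠ Pi.single x 1 := by
  intro hr
  rw [← List.dropLast_append_getLast hS] at hr h
  rw [rootOf_append A hA] at hr
  have := h _ (conj_sigma A hA hs _ _ _ hr)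
  simp at this

theorem cartan_symm {n : ℕ} (Λ : Fin n → Fin n → ℕ) (i j : Fin n) :
    cartanOf Λ i j = cartanOf Λ j i := by
  by_cases h : i = j
  · subst h; rfl
  · simp [cartanOf, h, Ne.symm h, edges, add_comm]

theorem brick_simple {k : Type} [Field k] {n : ℕ} (Λ : Fin n → Fin n → ℕ) (x : Fin n) :
    Brick (simpleRep Λ x : Rep k n Λ) := by
  refine ⟨fun h => by simpa [simpleRep] using h x, fun g => ?_⟩
  have h1 : Module.finrank k (Fin ((simpleRep Λ x : Rep k n Λ).d x) → k) = 1 := by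
    rw [Module.finrank_fin_fun]
    simp [simpleRep]
  obtain ⟨v, hv, hv'⟩ := finrank_eq_one_iff'.1 h1
  obtain ⟨c, hc⟩ := hv' (g.g x v)
  refine ⟨c, fun z w => ?_⟩
  by_cases hz : z = x
  · subst hz
    obtain ⟨b, rfl⟩ := hv' w
    rw [map_smul, ← hc, smul_comm]
  · have h0 : (simpleRep Λ x : Rep k n Λ).d z = 0 := by simp [simpleRep, hz]
    funext i
    exact (Fin.cast h0 i).elim0

theorem brick_Mof {k : Type} [Field k] {n : ℕ} (A : Fin n → Fin n → ℤ) (hA : ∀ i, A i i = 2)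
    (S : List (Fin n)) :
    ∀ (Λ : Fin n → Fin n → ℕ), cartanOf Λ = A → Admissible Λ S → S ≠ [] → Red A hA S →
      Brick (Mof Λ S : Rep k n Λ) ∧ dimv (Mof Λ S : Rep k n Λ) = rootOf A S := by
  induction S with
  | nil => intro _ _ _ h; exact absurd rfl h
  | cons x xs ih =>
    intro Λ hΛ hS _ hred
    cases xs with
    | nil =>
      refine ⟨brick_simple Λ x, ?_⟩
      funext z
      simp only [Mof, dimv, simpleRep, rootOf, Pi.single_apply]
      split <;> simp
    | cons y ys =>
      obtain ⟨h1, h2⟩ := ih (flipO x Λ) ((cartan_flip x Λ).trans hΛ) hS.2 (by simp) hred.tail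
      have hs : ∀ i j, A i j = A j i := by intro i j; rw [← hΛ]; exact cartan_symm Λ i j
      by_cases hinj : Function.Injective
          (outMap (flipO x Λ) (Mof (flipO x Λ) (y :: ys) : Rep k n (flipO x Λ)) x)
      · refine ⟨h1.minus x Λ hS.1 _ hinj, ?_⟩
        have := dimv_minus x Λ hS.1 _ hinj
        rw [h2, hΛ] at this
        exact this
      · exact absurd (h2.symm.trans (brick_out x Λ hS.1 _ h1 hinj))
          (red_root_ne A hA hs x _ (by simp) hred)

end Aux

theorem Mof_indecomposable_preprojective
    (n : ℕ) (hn : 2 ≤ n) (Λ : Fin n → Fin n → ℕ)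
    (hloop : ∀ a, Λ a a = 0)
    (hconn : ∀ a b : Fin n, Relation.ReflTransGen (fun u v => edges Λ u v ≠ 0) a b)
    (hacyc : ∀ a : Fin n, ¬ Relation.TransGen (fun u v => Λ u v ≠ 0) a a)
    (k : Type) [Field k]
    (S : List (Fin n)) (hadm : Admissible Λ S) (hne : S ≠ [])
    (hred : IsReducedSeq Λ S) :
    Indecomp (Mof Λ S : Rep k n Λ) ∧ Preprojective Λ (Mof Λ S : Rep k n Λ) := by
  obtain ⟨h1, h2⟩ := brick_Mof (k := k) (cartanOf Λ) (cartan_diag Λ) S Λ rfl hadm hne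
    (red_of_reduced Λ S hred)
  exact ⟨h1.indecomp, S, hadm, preproj_aux S Λ _ hadm hne h1 h2⟩

end KP
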